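/- arXiv:2403.03590 — 2 statements merged into one kernel-verified Lean document; each statement's English description precedes it below -/
import Mathlib

section
/- Let m, n, h be natural numbers with n ≤ h. Let A be a real m × n matrix, b a real row vector of length n, H a real n × h matrix with rank H = n, and H⁻ := Hᵀ (H Hᵀ)⁻¹. Then for every real row vector x of length m, ((x · (A · H)) · H⁻) + b = (x · A) + b. In other words, the composition of the layer F¹(x) = x (A H) with the layer F²(y) = y H⁻ + b coincides, as a function of x, with the original linear layer F(x) = x A + b. -/
open Matrix

/-- A square matrix over a field whose rank equals its size is invertible. -/
theorem Matrix.isUnit_of_rank_eq_card {ι K : Type*} [Fintype ι] [DecidableEq ι] [Field K]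
    {M : Matrix ι ι K} (hM : M.rank = Fintype.card ι) : IsUnit M := by
  rw [← linearIndependent_rows_iff_isUnit, linearIndependent_iff_card_eq_finrank_span,
    ← hM, rank_eq_finrank_span_row]
  rfl

/-- The right pseudo-inverse of a real matrix of full row rank is a right inverse. -/
theorem Matrix.mul_transpose_mul_inv_of_rank_eq_card {ι κ : Type*} [Fintype ι] [DecidableEq ι]
    [Fintype κ] {H : Matrix ι κ ℝ} (hH : H.rank = Fintype.card ι) :
    H * (Hᵀ * (H * Hᵀ)⁻¹) = 1 := by
  have hu : IsUnit (H * Hᵀ) := isUnit_of_rank_eq_card (by rw [rank_self_mul_transpose, hH])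
  rw [← Matrix.mul_assoc, mul_nonsing_inv _ ((isUnit_iff_isUnit_det _).mp hu)]

theorem stmt_3 (m n h : ℕ) (hnh : n ≤ h)
    (A : Matrix (Fin m) (Fin n) ℝ) (b : Fin n → ℝ)
    (H : Matrix (Fin n) (Fin h) ℝ) (hrank : H.rank = n) :
    ∀ x : Fin m → ℝ,
      ((x ᵥ* (A * H)) ᵥ* (Hᵀ * (H * Hᵀ)⁻¹)) + b = (x ᵥ* A) + b := by
  intro x
  rw [vecMul_vecMul, Matrix.mul_assoc A H,
    mul_transpose_mul_inv_of_rank_eq_card (by rw [hrank, Fintype.card_fin]), Matrix.mul_one]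
end

section
/- Let m, n, q, h be natural numbers with n ≤ h. Let A be a real m × n matrix and b a real row vector of length n (the watermarked layer), let A' be a real n × q matrix and b' a real row vector of length q (the subsequent layer), and let H be a real n × h matrix with rank H = n and H⁻ := Hᵀ (H Hᵀ)⁻¹. Then for every real row vector x of length m, (x · (A · H)) · (H⁻ · A') + (b · A' + b') = ((x · A + b) · A') + b'. That is, the obfuscated layer with weights A H followed by the merged layer with weights H⁻ A' and bias b A' + b' computes exactly the composition of the two original linear layers. -/
open Matrix

theorem stmt_5 (m n q h : ℕ) (hnh : n ≤ h)
    (A : Matrix (Fin m) (Fin n) ℝ) (b : Fin n → ℝ)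
    (A' : Matrix (Fin n) (Fin q) ℝ) (b' : Fin q → ℝ)
    (H : Matrix (Fin n) (Fin h) ℝ) (hrank : H.rank = n) :
    ∀ x : Fin m → ℝ,
      ((x ᵥ* (A * H)) ᵥ* ((Hᵀ * (H * Hᵀ)⁻¹) * A')) + ((b ᵥ* A') + b')
        = (((x ᵥ* A) + b) ᵥ* A') + b' := by
  intro x
  have hinv : H * (Hᵀ * (H * Hᵀ)⁻¹) = 1 :=
    mul_transpose_mul_inv_of_rank_eq_card (by rw [hrank, Fintype.card_fin])
  have hweights : A * H * (Hᵀ * (H * Hᵀ)⁻¹ * A') = A * A' := by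
    rw [Matrix.mul_assoc, ← Matrix.mul_assoc H, hinv, Matrix.one_mul]
  rw [vecMul_vecMul, hweights, add_vecMul, vecMul_vecMul, add_assoc]
end
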